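/- arXiv:1611.02251 — 4 statements merged into one kernel-verified Lean document; each statement's English description precedes it below -/
import Mathlib

section
/- For every fixed k ≥ 1, the limit λ_k = lim_{m→∞} 15^m λ_k(m) exists as a finite real number, the limit being taken over those m with 5^m ≥ k, and the sequence m ↦ 15^m λ_k(m) is nondecreasing in m; moreover 0 = λ_1 ≤ λ_2 ≤ λ_3 ≤ … . -/
open scoped BigOperators

noncomputable section

namespace VNLE

/-- `N_m = 2·5^m`, the number of points on the circle at level `m`. -/
def Nm (m : ℕ) : ℕ := 2 * 5 ^ m

/-- The partner of a vertex `n` of `K_m`: writing the representative `v` of `n`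
(taking `v = 2·5^m` when `n = 0`) as `v = 5^k·a` with `5 ∤ a`, the partner is
`n + 5^k` if `a ≡ 1` or `3 (mod 5)`, and `n - 5^k` if `a ≡ 2` or `4 (mod 5)`.
This realizes the identifications `5^k(1+5j) ∼ 5^k(2+5j)` and
`5^k(3+5j) ∼ 5^k(4+5j)` in `ℤ/(2·5^m)ℤ`. -/
def partner (m : ℕ) (n : ZMod (Nm m)) : ZMod (Nm m) :=
  let v : ℕ := if n.val = 0 then Nm m else n.val
  let k : ℕ := padicValNat 5 v
  if (v / 5 ^ k) % 5 = 1 ∨ (v / 5 ^ k) % 5 = 3 then n + ((5 ^ k : ℕ) : ZMod (Nm m))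
  else n - ((5 ^ k : ℕ) : ZMod (Nm m))

/-- A function on `K_m`: a map on `ℤ/N_mℤ` constant on the identified pairs. -/
def IsKFun (m : ℕ) (u : ZMod (Nm m) → ℝ) : Prop := ∀ n, u (partner m n) = u n

/-- The graph Laplacian `−Δ_m`. -/
def lap (m : ℕ) (u : ZMod (Nm m) → ℝ) : ZMod (Nm m) → ℝ := fun n =>
  4 * u n - u (n + 1) - u (n - 1) - u (partner m n + 1) - u (partner m n - 1)

/-- `u` is a `λ`-eigenfunction of `−Δ_m`. -/
def IsEigen (m : ℕ) (lam : ℝ) (u : ZMod (Nm m) → ℝ) : Prop :=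
  IsKFun m u ∧ u ≠ 0 ∧ ∀ n, lap m u n = lam * u n

/-- The spectral decimation renormalization polynomial `R(x) = x(3−x)(5−x)`. -/
def R (x : ℝ) : ℝ := x * (3 - x) * (5 - x)

/-- The `λ'`-extension of a function on `K_m` to a function on `K_{m+1}`. -/
def extFun (m : ℕ) (lam' : ℝ) (u : ZMod (Nm m) → ℝ) : ZMod (Nm (m + 1)) → ℝ := fun x =>
  let n : ZMod (Nm m) := ((x.val / 5 : ℕ) : ZMod (Nm m))
  if x.val % 5 = 0 then u n
  else if x.val % 5 = 1 ∨ x.val % 5 = 2 then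
    ((2 - lam') * u n + u (n + 1)) / ((1 - lam') * (3 - lam'))
  else
    (u n + (2 - lam') * u (n + 1)) / ((1 - lam') * (3 - lam'))

/-- Restriction of a function on `K_{m+1}` to the old vertices, giving a function on `K_m`. -/
def down (m : ℕ) (v : ZMod (Nm (m + 1)) → ℝ) : ZMod (Nm m) → ℝ := fun n =>
  v (((5 * n.val : ℕ) : ZMod (Nm (m + 1))))

/-- The Laplacian `−Δ_m` as a linear map. -/
def lapL (m : ℕ) : (ZMod (Nm m) → ℝ) →ₗ[ℝ] (ZMod (Nm m) → ℝ) where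
  toFun := lap m
  map_add' u v := by funext n; simp only [lap, Pi.add_apply]; ring
  map_smul' c u := by funext n; simp only [lap, Pi.smul_apply, smul_eq_mul, RingHom.id_apply]; ring

/-- The subspace of functions on `K_m` (maps constant on identified pairs). -/
def KFunSub (m : ℕ) : Submodule ℝ (ZMod (Nm m) → ℝ) where
  carrier := {u | IsKFun m u}
  add_mem' := by
    intro u v hu hv n
    simp only [Pi.add_apply, hu n, hv n]
  zero_mem' := fun _ => rfl
  smul_mem' := by
    intro c u hu n
    simp only [Pi.smul_apply, hu n]

/-- The `λ`-eigenspace of `−Δ_m` inside the space of functions on `K_m`. -/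
def eigensp (m : ℕ) (lam : ℝ) : Submodule ℝ (ZMod (Nm m) → ℝ) :=
  LinearMap.ker (lapL m - lam • LinearMap.id) ⊓ KFunSub m

/-- `c = (8 − √19)/3`, the smaller critical point of `R`. -/
def cpt : ℝ := (8 - Real.sqrt 19) / 3

/-- `φ₁`, the inverse of the (strictly increasing) restriction of `R` to `[0, c]`. -/
def phi1 : ℝ → ℝ := Function.invFunOn R (Set.Icc 0 cpt)

/-- Eigenvalue counting function: total dimension of the eigenspaces of `−Δ_m`
with eigenvalue `≤ t`. -/
def evCount (m : ℕ) (t : ℝ) : ℕ :=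
  Module.finrank ℝ ↥(⨆ lam ∈ Set.Iic t, eigensp m lam)

/-- `evSorted m k = λ_k(m)`, the `k`-th smallest eigenvalue (with multiplicity,
`1 ≤ k ≤ 5^m`) of `−Δ_m` acting on functions on `K_m`. -/
def evSorted (m k : ℕ) : ℝ := sInf {t : ℝ | k ≤ evCount m t}

/-- The restriction of a function on the circle `ℝ/ℤ` to the level-`m` vertices. -/
def restr (u : AddCircle (1 : ℝ) → ℝ) (m : ℕ) : ZMod (Nm m) → ℝ := fun n =>
  u (((n.val : ℝ) / (Nm m : ℝ) : ℝ) : AddCircle (1 : ℝ))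

/-- A continuous function on the circle is admissible if at every level its values
agree on identified pairs, so that its restrictions are functions on `K_m`. -/
def Admissible (u : AddCircle (1 : ℝ) → ℝ) : Prop :=
  Continuous u ∧ ∀ m, 1 ≤ m → ∀ n : ZMod (Nm m), restr u m (partner m n) = restr u m n

/-- `u` is a `λ`-eigenfunction of `−Δ` on `K`: it is admissible, nonzero, and
`sup_n |15^m (−Δ_m u_m)(n) − λ u(n/N_m)| → 0` as `m → ∞`. -/
def IsEigenK (lam : ℝ) (u : AddCircle (1 : ℝ) → ℝ) : Prop :=
  Admissible u ∧ u ≠ 0 ∧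
    ∀ ε : ℝ, 0 < ε → ∃ M : ℕ, ∀ m, M ≤ m → ∀ n : ZMod (Nm m),
      |(15 : ℝ) ^ m * lap m (restr u m) n - lam * restr u m n| < ε

/-- The symmetry-type subspace `V_{ε₁,ε₂}` of functions on `K_m`. -/
def symSub (m : ℕ) (e1 e2 : ℝ) : Submodule ℝ (ZMod (Nm m) → ℝ) where
  carrier := {u | IsKFun m u ∧ (∀ n, u (-n) = e1 * u n) ∧
    (∀ n, u (((5 ^ m : ℕ) : ZMod (Nm m)) - n) = e2 * u n)}
  add_mem' := by
    rintro u v ⟨hu, hu1, hu2⟩ ⟨hv, hv1, hv2⟩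
    refine ⟨fun n => by simp only [Pi.add_apply, hu n, hv n],
      fun n => by simp only [Pi.add_apply, hu1 n, hv1 n]; ring,
      fun n => by simp only [Pi.add_apply, hu2 n, hv2 n]; ring⟩
  zero_mem' := ⟨fun _ => rfl, fun n => by simp, fun n => by simp⟩
  smul_mem' := by
    rintro c u ⟨hu, hu1, hu2⟩
    refine ⟨fun n => by simp only [Pi.smul_apply, hu n],
      fun n => by simp only [Pi.smul_apply, smul_eq_mul, hu1 n]; ring,
      fun n => by simp only [Pi.smul_apply, smul_eq_mul, hu2 n]; ring⟩

instance neZero_Nm (m : ℕ) : NeZero (Nm m) := ⟨by unfold Nm; positivity⟩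

lemma Nm_succ (m : ℕ) : Nm (m + 1) = 5 * Nm m := by
  unfold Nm; ring

/-- The embedding of the level-`m` vertices into the level-`(m + 1)` vertices. -/
def old (m : ℕ) (n : ZMod (Nm m)) : ZMod (Nm (m + 1)) := ((5 * n.val : ℕ) : ZMod (Nm (m + 1)))

lemma old_natCast (m a : ℕ) : old m (a : ZMod (Nm m)) = ((5 * a : ℕ) : ZMod (Nm (m + 1))) := by
  rw [old, ZMod.natCast_eq_natCast_iff, ZMod.val_natCast, Nm_succ]
  exact (Nat.mod_modEq a (Nm m)).mul_left' 5

lemma old_add (m : ℕ) (x y : ZMod (Nm m)) : old m (x + y) = old m x + old m y := by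
  rw [← ZMod.natCast_zmod_val x, ← ZMod.natCast_zmod_val y, ← Nat.cast_add,
    old_natCast, old_natCast, old_natCast]
  push_cast
  ring

lemma old_sub (m : ℕ) (x y : ZMod (Nm m)) : old m (x - y) = old m x - old m y := by
  rw [eq_sub_iff_add_eq, ← old_add, sub_add_cancel]

lemma old_add_one (m : ℕ) (x : ZMod (Nm m)) : old m (x + 1) = old m x + 5 := by
  have h := old_natCast m 1
  push_cast at h
  rw [old_add, h]

lemma old_sub_one (m : ℕ) (x : ZMod (Nm m)) : old m (x - 1) = old m x - 5 := by
  have h := old_natCast m 1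
  push_cast at h
  rw [old_sub, h]

lemma val_old_add (m : ℕ) (n : ZMod (Nm m)) {r : ℕ} (hr : r < 5) :
    (old m n + (r : ZMod (Nm (m + 1)))).val = 5 * n.val + r := by
  rw [old, ← Nat.cast_add, ZMod.val_natCast, Nm_succ]
  have := n.val_lt
  exact Nat.mod_eq_of_lt (by omega)

lemma exists_old_add (m : ℕ) (x : ZMod (Nm (m + 1))) :
    ∃ n : ZMod (Nm m), ∃ r : ℕ, r < 5 ∧ x = old m n + (r : ZMod (Nm (m + 1))) := by
  refine ⟨((x.val / 5 : ℕ) : ZMod (Nm m)), x.val % 5, Nat.mod_lt _ (by norm_num), ?_⟩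
  rw [old_natCast, ← Nat.cast_add, Nat.div_add_mod, ZMod.natCast_zmod_val]

lemma forall_old_add {m : ℕ} {p : ZMod (Nm (m + 1)) → Prop} (h0 : ∀ n, p (old m n))
    (h1 : ∀ n, p (old m n + 1)) (h2 : ∀ n, p (old m n + 2)) (h3 : ∀ n, p (old m n + 3))
    (h4 : ∀ n, p (old m n + 4)) (x : ZMod (Nm (m + 1))) : p x := by
  obtain ⟨n, r, hr, rfl⟩ := exists_old_add m x
  interval_cases r
  · simpa using h0 n
  · simpa using h1 n
  · simpa using h2 n
  · simpa using h3 n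
  · simpa using h4 n

lemma partner_old (m : ℕ) (n : ZMod (Nm m)) : partner (m + 1) (old m n) = old m (partner m n) := by
  have hv : (old m n).val = 5 * n.val := by simpa using val_old_add m n (r := 0) (by norm_num)
  have key : ∀ v : ℕ, v ≠ 0 → padicValNat 5 (5 * v) = padicValNat 5 v + 1 := by
    intro v hv
    have : Fact (Nat.Prime 5) := ⟨by norm_num⟩
    rw [padicValNat.mul (by norm_num) hv]; simp [add_comm]
  have hval : (if (old m n).val = 0 then Nm (m + 1) else (old m n).val) =
      5 * (if n.val = 0 then Nm m else n.val) := by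
    rw [hv, Nm_succ]; split_ifs <;> omega
  have hne : (if n.val = 0 then Nm m else n.val) ≠ 0 := by
    split_ifs with h
    · exact NeZero.ne _
    · exact h
  unfold partner
  simp only [hval, key _ hne]
  generalize (if n.val = 0 then Nm m else n.val) = v
  rw [pow_succ', Nat.mul_div_mul_left _ _ (by norm_num : 0 < 5)]
  split_ifs
  · rw [old_add, old_natCast]
  · rw [old_sub, old_natCast]

lemma partner_of_val_mod {m : ℕ} {x : ZMod (Nm m)} (h : x.val % 5 ≠ 0) :
    partner m x = if x.val % 5 = 1 ∨ x.val % 5 = 3 then x + 1 else x - 1 := by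
  have h0 : x.val ≠ 0 := fun h' => h (by rw [h'])
  have hk : padicValNat 5 x.val = 0 :=
    padicValNat.eq_zero_of_not_dvd fun hd => h (Nat.mod_eq_zero_of_dvd hd)
  simp [partner, h0, hk]

lemma partner_old_add (m : ℕ) (n : ZMod (Nm m)) :
    partner (m + 1) (old m n + 1) = old m n + 2 ∧ partner (m + 1) (old m n + 2) = old m n + 1 ∧
    partner (m + 1) (old m n + 3) = old m n + 4 ∧ partner (m + 1) (old m n + 4) = old m n + 3 := by
  have h1 := val_old_add m n (r := 1) (by norm_num)
  have h2 := val_old_add m n (r := 2) (by norm_num)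
  have h3 := val_old_add m n (r := 3) (by norm_num)
  have h4 := val_old_add m n (r := 4) (by norm_num)
  push_cast at h1 h2 h3 h4
  refine ⟨?_, ?_, ?_, ?_⟩
  · rw [partner_of_val_mod (by omega), if_pos (by omega)]; ring
  · rw [partner_of_val_mod (by omega), if_neg (by omega)]; ring
  · rw [partner_of_val_mod (by omega), if_pos (by omega)]; ring
  · rw [partner_of_val_mod (by omega), if_neg (by omega)]; ring

lemma partner_zero (n : ZMod (Nm 0)) : partner 0 n = n + 1 := by
  have hv : n.val < 2 := n.val_lt
  have h1 : (1 : ZMod (Nm 0)) = -1 := by change (1 : ZMod 2) = -1; decide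
  by_cases h : n.val = 0
  · have h5 : padicValNat 5 (Nm 0) = 0 := padicValNat.eq_zero_of_not_dvd (by norm_num [Nm])
    simp only [partner]
    rw [if_pos h, h5, if_neg (by norm_num [Nm])]
    simp [sub_eq_add_neg, ← h1]
  · rw [partner_of_val_mod (by omega), if_pos (by omega)]

lemma partner_partner (m : ℕ) (n : ZMod (Nm m)) : partner m (partner m n) = n := by
  induction m with
  | zero =>
    have h1 : (1 + 1 : ZMod (Nm 0)) = 0 := by change (1 + 1 : ZMod 2) = 0; decide
    rw [partner_zero, partner_zero, add_assoc, h1, add_zero]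
  | succ m ih =>
    revert n
    refine forall_old_add (fun n => ?_) (fun n => ?_) (fun n => ?_) (fun n => ?_) (fun n => ?_)
    · rw [partner_old, partner_old, ih]
    all_goals simp only [partner_old_add m n]

lemma partner_one (m : ℕ) : partner m 1 = 1 + 1 := by
  have hv : (1 : ZMod (Nm m)).val = 1 := by
    have : Fact (1 < Nm m) := ⟨by
      have : 0 < 5 ^ m := by positivity
      unfold Nm
      omega⟩
    exact ZMod.val_one _
  rw [partner_of_val_mod (by omega), if_pos (by omega)]

lemma exists_partner_sign (m : ℕ) :
    ∃ s : ZMod (Nm m) → ℝ, (∀ n, s n ≠ 0) ∧ ∀ n, s (partner m n) = -s n := by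
  induction m with
  | zero =>
    refine ⟨fun n => if n = 0 then 1 else -1, fun n => by dsimp only; split_ifs <;> norm_num,
      fun n => ?_⟩
    rw [partner_zero]
    have : ∀ a : ZMod 2, (if a + 1 = 0 then (1 : ℝ) else -1) = -(if a = 0 then 1 else -1) := by
      intro a
      obtain rfl | rfl : a = 0 ∨ a = 1 := by revert a; decide
      · simp
      · rw [if_pos (by decide), if_neg (by decide), neg_neg]
    exact this n
  | succ m ih =>
    obtain ⟨s, hs0, hs⟩ := ih
    let t : ZMod (Nm (m + 1)) → ℝ := fun x =>
      if x.val % 5 = 0 then s ((x.val / 5 : ℕ) : ZMod (Nm m))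
      else if x.val % 5 = 1 ∨ x.val % 5 = 3 then 1 else -1
    have ht (n : ZMod (Nm m)) {r : ℕ} (hr : r < 5) : t (old m n + (r : ZMod (Nm (m + 1)))) =
        if r = 0 then s n else if r = 1 ∨ r = 3 then 1 else -1 := by
      have h1 : (5 * n.val + r) % 5 = r := by omega
      have h2 : (5 * n.val + r) / 5 = n.val := by omega
      simp only [t, val_old_add m n hr, h1, h2, ZMod.natCast_zmod_val]
    have ht0 n : t (old m n) = s n := by simpa using ht n (r := 0) (by norm_num)
    have ht1 n : t (old m n + 1) = 1 := by simpa using ht n (r := 1) (by norm_num)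
    have ht2 n : t (old m n + 2) = -1 := by simpa using ht n (r := 2) (by norm_num)
    have ht3 n : t (old m n + 3) = 1 := by simpa using ht n (r := 3) (by norm_num)
    have ht4 n : t (old m n + 4) = -1 := by simpa using ht n (r := 4) (by norm_num)
    refine ⟨t, ?_, ?_⟩
    · exact forall_old_add (fun n => by simpa [ht0] using hs0 n) (fun n => by simp [ht1])
        (fun n => by simp [ht2]) (fun n => by simp [ht3]) (fun n => by simp [ht4])
    · refine forall_old_add (fun n => ?_) (fun n => ?_) (fun n => ?_) (fun n => ?_) (fun n => ?_)
      · rw [partner_old, ht0, ht0, hs]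
      all_goals simp only [partner_old_add m n, ht1, ht2, ht3, ht4, neg_neg]

/-! ### Spectral decimation -/

lemma mem_eigensp {m : ℕ} {lam : ℝ} {u : ZMod (Nm m) → ℝ} :
    u ∈ eigensp m lam ↔ IsKFun m u ∧ ∀ n, lap m u n = lam * u n := by
  simp only [eigensp, Submodule.mem_inf, LinearMap.mem_ker, LinearMap.sub_apply,
    LinearMap.smul_apply, LinearMap.id_apply, sub_eq_zero, funext_iff, Pi.smul_apply, smul_eq_mul]
  exact and_comm

section Decimation

variable {m : ℕ} {v : ZMod (Nm (m + 1)) → ℝ}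

lemma lap_old (hv : IsKFun (m + 1) v) (n : ZMod (Nm m)) :
    lap (m + 1) v (old m n) = 4 * v (old m n) - v (old m n + 1) - v (old m (n - 1) + 3) -
      v (old m (partner m n) + 1) - v (old m (partner m n - 1) + 3) := by
  have h (k : ZMod (Nm m)) : v (old m k - 1) = v (old m (k - 1) + 3) := by
    rw [← hv (old m (k - 1) + 3), (partner_old_add m (k - 1)).2.2.1, old_sub_one]; congr 1; ring
  rw [lap, partner_old, h, h]

lemma lap_old_add (hv : IsKFun (m + 1) v) (n : ZMod (Nm m)) :
    lap (m + 1) v (old m n + 1) = 2 * v (old m n + 1) - v (old m n) - v (old m n + 3) ∧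
    lap (m + 1) v (old m n + 2) = 2 * v (old m n + 1) - v (old m n) - v (old m n + 3) ∧
    lap (m + 1) v (old m n + 3) = 2 * v (old m n + 3) - v (old m n + 1) - v (old m (n + 1)) ∧
    lap (m + 1) v (old m n + 4) = 2 * v (old m n + 3) - v (old m n + 1) - v (old m (n + 1)) := by
  obtain ⟨p1, p2, p3, p4⟩ := partner_old_add m n
  have h2 : v (old m n + 2) = v (old m n + 1) := by rw [← p1, hv]
  have h4 : v (old m n + 4) = v (old m n + 3) := by rw [← p3, hv]
  have e : ∀ x : ZMod (Nm (m + 1)), x + 1 + 1 = x + 2 ∧ x + 1 - 1 = x ∧ x + 2 + 1 = x + 3 ∧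
      x + 2 - 1 = x + 1 ∧ x + 3 + 1 = x + 4 ∧ x + 3 - 1 = x + 2 ∧ x + 4 + 1 = x + 5 ∧
      x + 4 - 1 = x + 3 := fun x => by refine ⟨?_, ?_, ?_, ?_, ?_, ?_, ?_, ?_⟩ <;> ring
  refine ⟨?_, ?_, ?_, ?_⟩ <;> simp only [lap, p1, p2, p3, p4, e, old_add_one, h2, h4] <;> ring

variable {lam : ℝ}

/-- On the five vertices of a subdivided edge an eigenfunction is determined by the end points. -/
lemma eigen_interior (hv : v ∈ eigensp (m + 1) lam) (n : ZMod (Nm m)) :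
    (1 - lam) * (3 - lam) * v (old m n + 1) = (2 - lam) * v (old m n) + v (old m (n + 1)) ∧
    (1 - lam) * (3 - lam) * v (old m n + 3) = v (old m n) + (2 - lam) * v (old m (n + 1)) := by
  obtain ⟨hK, hl⟩ := mem_eigensp.1 hv
  obtain ⟨l1, -, l3, -⟩ := lap_old_add hK n
  rw [hl] at l1 l3
  constructor
  · linear_combination -(2 - lam) * l1 - l3
  · linear_combination -l1 - (2 - lam) * l3

lemma down_apply (v : ZMod (Nm (m + 1)) → ℝ) (n : ZMod (Nm m)) : down m v n = v (old m n) := rfl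

lemma down_mem_eigensp (hv : v ∈ eigensp (m + 1) lam) : down m v ∈ eigensp m (R lam) := by
  obtain ⟨hK, hl⟩ := mem_eigensp.1 hv
  have hd : IsKFun m (down m v) := fun n => by rw [down_apply, ← partner_old, hK, down_apply]
  refine mem_eigensp.2 ⟨hd, fun n => ?_⟩
  have h := lap_old hK n
  have hp := hd n
  have i1 := (eigen_interior hv n).1
  have i2 := (eigen_interior hv (n - 1)).2
  have i3 := (eigen_interior hv (partner m n)).1
  have i4 := (eigen_interior hv (partner m n - 1)).2
  rw [sub_add_cancel] at i2 i4
  rw [hl] at h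
  simp only [lap, R, down_apply] at hp ⊢
  linear_combination -(1 - lam) * (3 - lam) * h + i1 + i2 + i3 + i4 + 2 * (2 - lam) * hp

lemma eq_zero_of_down_eq_zero (hv : v ∈ eigensp (m + 1) lam) (hlam : (1 - lam) * (3 - lam) ≠ 0)
    (h : down m v = 0) : v = 0 := by
  have h0 : ∀ n, v (old m n) = 0 := fun n => congrFun h n
  have h1 : ∀ n, v (old m n + 1) = 0 ∧ v (old m n + 3) = 0 := fun n => by
    simpa [h0, (mul_ne_zero_iff.1 hlam).1, (mul_ne_zero_iff.1 hlam).2] using eigen_interior hv n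
  have hK := (mem_eigensp.1 hv).1
  funext x
  refine forall_old_add (p := fun x => v x = 0) h0 (fun n => (h1 n).1) (fun n => ?_) (fun n => (h1 n).2) (fun n => ?_) x
  · rw [← hK, (partner_old_add m n).2.1]; exact (h1 n).1
  · rw [← hK, (partner_old_add m n).2.2.2]; exact (h1 n).2

lemma extFun_old_add (lam : ℝ) (u : ZMod (Nm m) → ℝ) (n : ZMod (Nm m)) {r : ℕ} (hr : r < 5) :
    extFun m lam u (old m n + (r : ZMod (Nm (m + 1)))) =
      if r = 0 then u n
      else if r = 1 ∨ r = 2 then ((2 - lam) * u n + u (n + 1)) / ((1 - lam) * (3 - lam))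
      else (u n + (2 - lam) * u (n + 1)) / ((1 - lam) * (3 - lam)) := by
  have h1 : (5 * n.val + r) % 5 = r := by omega
  have h2 : (5 * n.val + r) / 5 = n.val := by omega
  simp only [extFun, val_old_add m n hr, h1, h2, ZMod.natCast_zmod_val]

lemma extFun_mem_eigensp {u : ZMod (Nm m) → ℝ} (hu : u ∈ eigensp m (R lam))
    (hlam : (1 - lam) * (3 - lam) ≠ 0) :
    extFun m lam u ∈ eigensp (m + 1) lam ∧ down m (extFun m lam u) = u := by
  obtain ⟨hK, hl⟩ := mem_eigensp.1 hu
  set w := extFun m lam u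
  have w0 n : w (old m n) = u n := by
    simpa using extFun_old_add lam u n (r := 0) (by norm_num)
  have w1 n : w (old m n + 1) = ((2 - lam) * u n + u (n + 1)) / ((1 - lam) * (3 - lam)) := by
    simpa using extFun_old_add lam u n (r := 1) (by norm_num)
  have w2 n : w (old m n + 2) = ((2 - lam) * u n + u (n + 1)) / ((1 - lam) * (3 - lam)) := by
    simpa using extFun_old_add lam u n (r := 2) (by norm_num)
  have w3 n : w (old m n + 3) = (u n + (2 - lam) * u (n + 1)) / ((1 - lam) * (3 - lam)) := by
    simpa using extFun_old_add lam u n (r := 3) (by norm_num)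
  have w4 n : w (old m n + 4) = (u n + (2 - lam) * u (n + 1)) / ((1 - lam) * (3 - lam)) := by
    simpa using extFun_old_add lam u n (r := 4) (by norm_num)
  have hwK : IsKFun (m + 1) w := by
    refine forall_old_add (fun n => ?_) (fun n => ?_) (fun n => ?_) (fun n => ?_) (fun n => ?_)
    · rw [partner_old, w0, w0, hK]
    all_goals simp only [partner_old_add m n, w1, w2, w3, w4]
  obtain ⟨hl1, hl3⟩ := mul_ne_zero_iff.1 hlam
  refine ⟨mem_eigensp.2 ⟨hwK, ?_⟩, funext w0⟩
  refine forall_old_add (fun n => ?_) (fun n => ?_) (fun n => ?_) (fun n => ?_) (fun n => ?_)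
  · have h := hl n
    have hp := hK n
    rw [lap_old hwK]
    simp only [w0, w1, w3, sub_add_cancel]
    simp only [lap, R] at h
    field_simp
    linear_combination h - 2 * (2 - lam) * hp
  · rw [(lap_old_add hwK n).1]
    simp only [w0, w1, w3]
    field_simp
    ring
  · rw [(lap_old_add hwK n).2.1]
    simp only [w0, w1, w2, w3]
    field_simp
    ring
  · rw [(lap_old_add hwK n).2.2.1]
    simp only [w0, w1, w3]
    field_simp
    ring
  · rw [(lap_old_add hwK n).2.2.2]
    simp only [w0, w1, w3, w4]
    field_simp
    ring

end Decimation

/-! ### Bounds on the spectrum -/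

lemma exists_forall_abs_le (m : ℕ) (u : ZMod (Nm m) → ℝ) : ∃ n, ∀ k, |u k| ≤ |u n| :=
  Finite.exists_max fun n => |u n|

lemma eigensp_eq_bot_of_lt_zero {m : ℕ} {lam : ℝ} (h : lam < 0) : eigensp m lam = ⊥ := by
  rw [Submodule.eq_bot_iff]
  intro u hu
  obtain ⟨-, hl⟩ := mem_eigensp.1 hu
  obtain ⟨n, hn⟩ := exists_forall_abs_le m u
  have e := hl n
  simp only [lap] at e
  have a1 := hn (n + 1)
  have a2 := hn (n - 1)
  have a3 := hn (partner m n + 1)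
  have a4 := hn (partner m n - 1)
  have h0 : |u n| = 0 := by
    rcases le_total 0 (u n) with h' | h'
    · rw [abs_of_nonneg h'] at *
      rw [abs_le] at a1 a2 a3 a4
      nlinarith
    · rw [abs_of_nonpos h'] at *
      rw [abs_le] at a1 a2 a3 a4
      nlinarith
  funext k
  simpa [h0] using hn k

lemma eigensp_eq_bot_of_eight_le {m : ℕ} {lam : ℝ} (h : 8 ≤ lam) : eigensp m lam = ⊥ := by
  rw [Submodule.eq_bot_iff]
  intro u hu
  obtain ⟨hK, hl⟩ := mem_eigensp.1 hu
  obtain ⟨n, hn⟩ := exists_forall_abs_le m u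
  have step : ∀ k, |u k| = |u n| → u (k + 1) = -u k := by
    intro k hk
    have e := hl k
    simp only [lap] at e
    have a1 := hn (k + 1)
    have a2 := hn (k - 1)
    have a3 := hn (partner m k + 1)
    have a4 := hn (partner m k - 1)
    rw [← hk] at a1 a2 a3 a4
    rcases le_total 0 (u k) with h' | h'
    · rw [abs_of_nonneg h'] at *
      rw [abs_le] at a1 a2 a3 a4
      nlinarith
    · rw [abs_of_nonpos h'] at *
      rw [abs_le] at a1 a2 a3 a4
      nlinarith
  have all : ∀ j : ℕ, |u (n + j)| = |u n| := by
    intro j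
    induction j with
    | zero => simp
    | succ j ih => rw [Nat.cast_succ, ← add_assoc, step _ ih, abs_neg, ih]
  have h1 : |u 1| = |u n| := by
    simpa [ZMod.natCast_zmod_val] using all (1 - n).val
  have h2 := step 1 h1
  rw [← partner_one, hK] at h2
  have h0 : |u n| = 0 := by rw [← h1, abs_eq_zero]; linarith
  funext k
  simpa [h0] using hn k

/-! ### Completeness of the eigenfunctions -/

lemma lap_mem_KFunSub {m : ℕ} (u : ZMod (Nm m) → ℝ) (hu : u ∈ KFunSub m) :
    lapL m u ∈ KFunSub m := by
  intro n
  have := hu n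
  simp only [lapL, LinearMap.coe_mk, AddHom.coe_mk, lap, partner_partner, this]
  ring

lemma sum_comp_partner {m : ℕ} (f : ZMod (Nm m) → ℝ) : ∑ n, f (partner m n) = ∑ n, f n :=
  Equiv.sum_comp (Function.Involutive.toPerm (partner m) (partner_partner m)) f

lemma sum_lap_mul {m : ℕ} {u v : ZMod (Nm m) → ℝ} (hv : IsKFun m v) :
    ∑ n, lap m u n * v n = ∑ n, (4 * u n * v n - 2 * (u (n + 1) * v n + u n * v (n + 1))) := by
  have h1 : ∑ n, u (partner m n + 1) * v n = ∑ n, u (n + 1) * v n := by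
    rw [← sum_comp_partner fun n => u (n + 1) * v n]
    exact Finset.sum_congr rfl fun n _ => by rw [hv]
  have h2 : ∑ n, u (partner m n - 1) * v n = ∑ n, u (n - 1) * v n := by
    rw [← sum_comp_partner fun n => u (n - 1) * v n]
    exact Finset.sum_congr rfl fun n _ => by rw [hv]
  have h3 : ∑ n, u (n - 1) * v n = ∑ n, u n * v (n + 1) := by
    rw [← Equiv.sum_comp (Equiv.addRight (1 : ZMod (Nm m))) fun n => u (n - 1) * v n]
    simp
  simp only [lap, sub_mul, Finset.sum_sub_distrib, ← Finset.mul_sum, Finset.sum_add_distrib, h1,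
    h2, h3]
  ring

lemma sum_lap_mul_comm {m : ℕ} {u v : ZMod (Nm m) → ℝ} (hu : IsKFun m u) (hv : IsKFun m v) :
    ∑ n, lap m u n * v n = ∑ n, u n * lap m v n := by
  rw [sum_lap_mul hv, ← Finset.sum_congr rfl fun n _ => mul_comm (lap m v n) (u n), sum_lap_mul hu]
  exact Finset.sum_congr rfl fun n _ => by ring

lemma KFunSub_le_iSup_eigensp (m : ℕ) : KFunSub m ≤ ⨆ lam ∈ Set.Iic (8 : ℝ), eigensp m lam := by
  let e := (WithLp.linearEquiv 2 ℝ (ZMod (Nm m) → ℝ)).toLinearMap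
  let K : Submodule ℝ (EuclideanSpace ℝ (ZMod (Nm m))) := (KFunSub m).comap e
  let T : EuclideanSpace ℝ (ZMod (Nm m)) →ₗ[ℝ] EuclideanSpace ℝ (ZMod (Nm m)) :=
    (WithLp.linearEquiv 2 ℝ (ZMod (Nm m) → ℝ)).symm.toLinearMap ∘ₗ lapL m ∘ₗ e
  have hT : ∀ x ∈ K, T x ∈ K := fun x hx => lap_mem_KFunSub _ hx
  have hsymm : (T.restrict hT).IsSymmetric := by
    rintro ⟨x, hx⟩ ⟨y, hy⟩
    have := sum_lap_mul_comm hy hx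
    simpa [T, e, lapL, PiLp.inner_apply] using this.symm
  have htop : ⨆ μ, Module.End.eigenspace (T.restrict hT) μ = ⊤ :=
    Submodule.orthogonal_eq_bot_iff.1 hsymm.orthogonalComplement_iSup_eigenspaces_eq_bot
  intro u hu
  have hmem : (⟨WithLp.toLp 2 u, hu⟩ : K) ∈ ⨆ μ, Module.End.eigenspace (T.restrict hT) μ :=
    htop ▸ Submodule.mem_top
  have := Submodule.mem_map_of_mem (f := e ∘ₗ K.subtype) hmem
  rw [Submodule.map_iSup] at this
  refine (iSup_le fun μ => ?_ : (⨆ μ, Submodule.map _ _) ≤ _) this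
  rw [Submodule.map_le_iff_le_comap]
  intro x hx
  have hxe : e x ∈ eigensp m μ := by
    refine mem_eigensp.2 ⟨x.2, fun n => ?_⟩
    have hx' := congrArg (fun y : K => e y n) (Module.End.mem_eigenspace_iff.1 hx)
    exact hx'
  rcases le_or_gt μ 8 with h | h
  · exact Submodule.mem_iSup_of_mem μ (Submodule.mem_iSup_of_mem h hxe)
  · rw [eigensp_eq_bot_of_eight_le h.le] at hxe
    rw [Submodule.mem_comap, LinearMap.comp_apply, Submodule.subtype_apply,
      (Submodule.mem_bot ℝ).1 hxe]
    exact Submodule.zero_mem _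

lemma pow_le_finrank_KFunSub (m : ℕ) : 5 ^ m ≤ Module.finrank ℝ (KFunSub m) := by
  obtain ⟨s, hs0, hs⟩ := exists_partner_sign m
  let A : Submodule ℝ (ZMod (Nm m) → ℝ) :=
    { carrier := {u | ∀ n, u (partner m n) = -u n}
      add_mem' := fun hu hv n => by simp only [Pi.add_apply, hu n, hv n]; ring
      zero_mem' := fun n => by simp
      smul_mem' := fun c u hu n => by simp only [Pi.smul_apply, hu n, smul_neg] }
  have hsup : KFunSub m ⊔ A = ⊤ := by
    refine eq_top_iff.2 fun u _ => Submodule.mem_sup.2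
      ⟨fun n => (u n + u (partner m n)) / 2, fun n => ?_,
        fun n => (u n - u (partner m n)) / 2, fun n => ?_, ?_⟩
    · simp only [partner_partner]; ring
    · simp only [partner_partner]; ring
    · funext n; simp only [Pi.add_apply]; ring
  have hmul : ∀ u ∈ A, LinearMap.mulLeft ℝ s u ∈ KFunSub m := fun u hu n => by
    simp [hs, hu n]
  have hA : Module.finrank ℝ A ≤ Module.finrank ℝ (KFunSub m) := by
    refine LinearMap.finrank_le_finrank_of_injective
      (f := (LinearMap.mulLeft ℝ s).restrict hmul) fun x y hxy => Subtype.ext (funext fun n => ?_)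
    have := congrFun (congrArg Subtype.val hxy) n
    exact mul_left_cancel₀ (hs0 n) this
  have hle : 2 * 5 ^ m ≤ Module.finrank ℝ (KFunSub m) + Module.finrank ℝ A := by
    have := Submodule.finrank_add_le_finrank_add_finrank (KFunSub m) A
    rwa [hsup, finrank_top, Module.finrank_fintype_fun_eq_card, ZMod.card] at this
  omega

/-! ### Comparison of the counting functions -/

lemma pow_le_evCount_eight (m : ℕ) : 5 ^ m ≤ evCount m 8 :=
  (pow_le_finrank_KFunSub m).trans (Submodule.finrank_mono (KFunSub_le_iSup_eigensp m))

lemma evCount_of_neg {m : ℕ} {t : ℝ} (ht : t < 0) : evCount m t = 0 := by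
  have : (⨆ lam ∈ Set.Iic t, eigensp m lam) = ⊥ := by
    simp only [iSup_eq_bot]
    exact fun lam hl => eigensp_eq_bot_of_lt_zero (lt_of_le_of_lt hl ht)
  rw [evCount, this, finrank_bot]

lemma one_le_evCount_zero (m : ℕ) : 1 ≤ evCount m 0 := by
  have hmem : (1 : ZMod (Nm m) → ℝ) ∈ ⨆ lam ∈ Set.Iic (0 : ℝ), eigensp m lam := by
    refine Submodule.mem_iSup_of_mem 0 (Submodule.mem_iSup_of_mem (Set.mem_Iic.2 le_rfl) ?_)
    exact mem_eigensp.2 ⟨fun n => rfl, fun n => by simp [lap]; norm_num⟩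
  exact Submodule.one_le_finrank_iff.2 fun h => one_ne_zero ((Submodule.eq_bot_iff _).1 h _ hmem)

lemma R_strictMonoOn : StrictMonoOn R (Set.Iic 1) := by
  intro x hx y hy hxy
  rw [Set.mem_Iic] at hx hy
  unfold R
  nlinarith [mul_pos (sub_pos.2 hxy) (show (0 : ℝ) < 15 - 8 * (x + y) + x ^ 2 + x * y + y ^ 2 by
    nlinarith [sq_nonneg (x + y - 2), sq_nonneg (x - y)])]

lemma R_le {x : ℝ} (hx : x ≤ 8) : R x ≤ 15 * x := by
  unfold R; nlinarith [mul_nonneg (sq_nonneg x) (sub_nonneg.2 hx)]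

lemma exists_R_eq {t : ℝ} (h0 : 0 ≤ t) (h8 : t ≤ 8) : ∃ s ∈ Set.Icc (0 : ℝ) 1, R s = t := by
  have hc : ContinuousOn R (Set.Icc 0 1) := by unfold R; fun_prop
  have := intermediate_value_Icc zero_le_one hc
  exact this ⟨by simpa [R] using h0, by norm_num [R]; exact h8⟩

/-- `down` as a linear map. -/
def downL (m : ℕ) : (ZMod (Nm (m + 1)) → ℝ) →ₗ[ℝ] (ZMod (Nm m) → ℝ) :=
  LinearMap.funLeft ℝ ℝ (old m)

lemma evCount_succ_le {m : ℕ} {s : ℝ} (hs : s < 1) :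
    evCount (m + 1) s ≤ evCount m (15 * s) := by
  set W := ⨆ lam ∈ Set.Iic s, eigensp (m + 1) lam with hW
  have hmaps : ∀ w ∈ W, downL m w ∈ ⨆ lam ∈ Set.Iic (15 * s), eigensp m lam := by
    refine (iSup₂_le fun lam hl v hv => ?_ :
      W ≤ Submodule.comap (downL m) (⨆ lam ∈ Set.Iic (15 * s), eigensp m lam))
    have hl' : lam ≤ s := hl
    have hR : R lam ≤ 15 * s := (R_le (by linarith)).trans (by linarith)
    exact Submodule.mem_iSup_of_mem _ (Submodule.mem_iSup_of_mem hR (down_mem_eigensp hv))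
  have hinj : ∀ w ∈ W, downL m w = 0 → w = 0 := by
    intro w hw h0
    rw [hW, iSup_subtype', Submodule.mem_iSup_iff_exists_finsupp] at hw
    obtain ⟨f, hf, rfl⟩ := hw
    have hlt (i : Set.Iic s) : i.1 < 1 := lt_of_le_of_lt i.2 hs
    have hind : iSupIndep fun i : Set.Iic s => eigensp m (R i) := by
      refine ((Module.End.eigenspaces_iSupIndep (lapL m)).comp
        (f := fun i : Set.Iic s => R i) fun i j hij => ?_).mono fun i u hu => ?_
      · exact Subtype.ext (R_strictMonoOn.injOn (hlt i).le (hlt j).le hij)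
      · rw [Function.comp_apply, Module.End.mem_eigenspace_iff]
        exact funext (mem_eigensp.1 hu).2
    rw [iSupIndep_iff_finsetSum_eq_zero_imp_eq_zero] at hind
    rw [Finsupp.sum, map_sum] at h0
    refine Finset.sum_eq_zero fun i hi => ?_
    have hdi := hind f.support (fun i => downL m (f i)) (fun i _ => down_mem_eigensp (hf i)) h0 i hi
    have := hlt i
    exact eq_zero_of_down_eq_zero (hf i) (mul_pos (by linarith) (by linarith)).ne' hdi
  refine LinearMap.finrank_le_finrank_of_injective (f := (downL m).restrict hmaps) ?_
  rw [← LinearMap.ker_eq_bot, LinearMap.ker_eq_bot']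
  exact fun w hw => Subtype.ext (hinj w w.2 (congrArg Subtype.val hw))

lemma evCount_R_le {m : ℕ} {s : ℝ} (h1 : s ≤ 1) :
    evCount m (R s) ≤ evCount (m + 1) s := by
  refine le_trans (Submodule.finrank_mono ?_)
    (Submodule.finrank_map_le (downL m) (⨆ lam ∈ Set.Iic s, eigensp (m + 1) lam))
  refine iSup₂_le fun t ht u hu => ?_
  have hR1 : R 1 = 8 := by norm_num [R]
  have ht8 : t ≤ 8 := hR1 ▸ le_trans ht (R_strictMonoOn.monotoneOn h1 (Set.mem_Iic.2 le_rfl) h1)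
  rcases lt_or_ge t 0 with hneg | hpos
  · rw [eigensp_eq_bot_of_lt_zero hneg, Submodule.mem_bot] at hu
    exact hu ▸ Submodule.zero_mem _
  rcases eq_or_lt_of_le ht8 with rfl | hlt
  · rw [eigensp_eq_bot_of_eight_le le_rfl, Submodule.mem_bot] at hu
    exact hu ▸ Submodule.zero_mem _
  obtain ⟨r, ⟨-, hr1⟩, rfl⟩ := exists_R_eq hpos ht8
  have hr : r < 1 := lt_of_le_of_ne hr1 fun h => hlt.ne (h ▸ hR1)
  obtain ⟨hext, hdown⟩ := extFun_mem_eigensp hu (mul_pos (by linarith) (by linarith)).ne'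
  have hrs : r ≤ s := (R_strictMonoOn.le_iff_le hr1 h1).1 ht
  exact ⟨_, Submodule.mem_iSup_of_mem r (Submodule.mem_iSup_of_mem hrs hext), hdown⟩

/-! ### The sorted eigenvalues -/

lemma nonneg_of_le_evCount {m k : ℕ} (hk : 1 ≤ k) {t : ℝ} (h : k ≤ evCount m t) : 0 ≤ t := by
  by_contra! ht
  rw [evCount_of_neg ht] at h
  omega

lemma evSorted_le {m k : ℕ} (hk : 1 ≤ k) {t : ℝ} (h : k ≤ evCount m t) : evSorted m k ≤ t :=
  csInf_le ⟨0, fun _ hs => nonneg_of_le_evCount hk hs⟩ h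

lemma le_evSorted {m k : ℕ} (hk : k ≤ 5 ^ m) {b : ℝ} (h : ∀ t, k ≤ evCount m t → b ≤ t) :
    b ≤ evSorted m k :=
  le_csInf ⟨8, hk.trans (pow_le_evCount_eight m)⟩ h

lemma evSorted_one (m : ℕ) : evSorted m 1 = 0 :=
  le_antisymm (evSorted_le le_rfl (one_le_evCount_zero m))
    (le_evSorted (Nat.one_le_pow _ _ (by norm_num)) fun _ => nonneg_of_le_evCount le_rfl)

lemma evSorted_le_evSorted {m k l : ℕ} (hk : 1 ≤ k) (hkl : k ≤ l) (hl : l ≤ 5 ^ m) :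
    evSorted m k ≤ evSorted m l :=
  le_evSorted hl fun _ ht => evSorted_le hk (hkl.trans ht)

lemma evSorted_le_succ {m k : ℕ} (hk : 1 ≤ k) (hkm : k ≤ 5 ^ m) :
    evSorted m k ≤ 15 * evSorted (m + 1) k := by
  suffices evSorted m k / 15 ≤ evSorted (m + 1) k by linarith
  refine le_evSorted (hkm.trans (Nat.pow_le_pow_right (by norm_num) m.le_succ)) fun s hs => ?_
  rw [div_le_iff₀' (by norm_num)]
  rcases lt_or_ge s 1 with h1 | h1
  · exact evSorted_le hk (hs.trans (evCount_succ_le h1))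
  · exact (evSorted_le hk (hkm.trans (pow_le_evCount_eight m))).trans (by linarith)

lemma exists_le_evCount_add {m k : ℕ} (hkm : k ≤ 5 ^ m) (j : ℕ) :
    ∃ t : ℝ, 0 ≤ t ∧ t ≤ 8 ∧ k ≤ evCount (m + j) t ∧ (15 : ℝ) ^ j * (t * (1 + t)) ≤ 72 := by
  induction j with
  | zero =>
    exact ⟨8, by norm_num, le_rfl, hkm.trans (pow_le_evCount_eight m), by norm_num⟩
  | succ j ih =>
    obtain ⟨t, h0, h8, hk, hb⟩ := ih
    obtain ⟨s, ⟨hs0, hs1⟩, rfl⟩ := exists_R_eq h0 h8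
    refine ⟨s, hs0, by linarith, hk.trans (evCount_R_le hs1), le_trans ?_ hb⟩
    rw [pow_succ, mul_assoc]
    refine mul_le_mul_of_nonneg_left ?_ (by positivity)
    have hp : 8 ≤ (3 - s) * (5 - s) := by nlinarith
    have hR : R s = s * ((3 - s) * (5 - s)) := by unfold R; ring
    have hkey : 15 * (1 + s) ≤ (3 - s) * (5 - s) * (1 + R s) := by
      rw [hR]
      nlinarith [mul_nonneg hs0 (mul_nonneg (sub_nonneg.2 hp) (sub_nonneg.2 hp)),
        mul_nonneg hs0 (sub_nonneg.2 hp)]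
    calc 15 * (s * (1 + s)) = s * (15 * (1 + s)) := by ring
      _ ≤ s * ((3 - s) * (5 - s) * (1 + R s)) := by gcongr
      _ = R s * (1 + R s) := by rw [hR]; ring

lemma pow_mul_evSorted_le_succ {m k : ℕ} (hk : 1 ≤ k) (hkm : k ≤ 5 ^ m) :
    (15 : ℝ) ^ m * evSorted m k ≤ (15 : ℝ) ^ (m + 1) * evSorted (m + 1) k := by
  rw [pow_succ, mul_assoc]
  gcongr
  exact evSorted_le_succ hk hkm

lemma le_pow_five (k j : ℕ) : k ≤ 5 ^ (k + j) :=
  (Nat.lt_pow_self (by norm_num)).le.trans (Nat.pow_le_pow_right (by norm_num) (k.le_add_right j))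

lemma exists_tendsto_pow_mul_evSorted {k : ℕ} (hk : 1 ≤ k) :
    ∃ L : ℝ, Filter.Tendsto (fun m => (15 : ℝ) ^ m * evSorted m k) Filter.atTop (nhds L) := by
  have hmono : Monotone fun j => (15 : ℝ) ^ (j + k) * evSorted (j + k) k :=
    monotone_nat_of_le_succ fun j => by
      rw [add_right_comm]
      exact pow_mul_evSorted_le_succ hk (add_comm k j ▸ le_pow_five k j)
  have hbdd : BddAbove (Set.range fun j => (15 : ℝ) ^ (j + k) * evSorted (j + k) k) := by
    refine ⟨15 ^ k * 72, ?_⟩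
    rintro _ ⟨j, rfl⟩
    obtain ⟨t, h0, -, ht, hb⟩ := exists_le_evCount_add (le_pow_five k 0) j
    rw [add_zero, add_comm] at ht
    calc (15 : ℝ) ^ (j + k) * evSorted (j + k) k ≤ 15 ^ (j + k) * t := by
          gcongr; exact evSorted_le hk ht
      _ = 15 ^ k * (15 ^ j * t) := by ring
      _ ≤ 15 ^ k * (15 ^ j * (t * (1 + t))) := by gcongr; nlinarith
      _ ≤ 15 ^ k * 72 := by gcongr
  exact ⟨_, (Filter.tendsto_add_atTop_iff_nat k).1 (tendsto_atTop_ciSup hmono hbdd)⟩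

/-- For each fixed `k ≥ 1` the limit `λ_k = lim_m 15^m λ_k(m)` exists,
the sequence `m ↦ 15^m λ_k(m)` being nondecreasing (over those `m` with `5^m ≥ k`);
moreover `0 = λ_1 ≤ λ_2 ≤ λ_3 ≤ …`. -/
theorem renormalized_eigenvalues_converge :
    ∃ L : ℕ → ℝ,
      (∀ k, 1 ≤ k →
        Filter.Tendsto (fun m => (15 : ℝ) ^ m * evSorted m k) Filter.atTop (nhds (L k))) ∧
      (∀ k, 1 ≤ k → ∀ m, k ≤ 5 ^ m →
        (15 : ℝ) ^ m * evSorted m k ≤ (15 : ℝ) ^ (m + 1) * evSorted (m + 1) k) ∧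
      L 1 = 0 ∧
      (∀ k, 1 ≤ k → L k ≤ L (k + 1)) := by
  choose! L hL using fun (k : ℕ) (hk : 1 ≤ k) => exists_tendsto_pow_mul_evSorted hk
  refine ⟨L, hL, fun k hk m hkm => pow_mul_evSorted_le_succ hk hkm, ?_, fun k hk => ?_⟩
  · refine tendsto_nhds_unique (hL 1 le_rfl) ?_
    simp [evSorted_one]
  · refine le_of_tendsto_of_tendsto (hL k hk) (hL (k + 1) (by omega)) ?_
    filter_upwards [Filter.eventually_ge_atTop (k + 1)] with m hm
    gcongr
    refine evSorted_le_evSorted hk k.le_succ ?_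
    obtain ⟨j, rfl⟩ := Nat.exists_eq_add_of_le hm
    exact le_pow_five _ _

end VNLE
end
end

section
/- Let λ ∈ [0, 4+√2] and define λ_0 = λ and λ_{j+1} = φ₁(λ_j) for j ≥ 0. Then the sequence j ↦ 15^j λ_j is nondecreasing and converges to a finite limit. -/
open scoped BigOperators

noncomputable section

namespace VNLE

theorem one_le_cpt : 1 ≤ cpt := by
  have h : Real.sqrt 19 ≤ 5 := Real.sqrt_le_iff.mpr (by norm_num)
  unfold cpt
  linarith

theorem cpt_le : cpt ≤ 5 / 4 := by
  have h : 17 / 4 ≤ Real.sqrt 19 := Real.le_sqrt_of_sq_le (by norm_num)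
  unfold cpt
  linarith

theorem mem_image_R {y : ℝ} (hy : y ∈ Set.Icc (0 : ℝ) 6) : ∃ x ∈ Set.Icc 0 cpt, R x = y := by
  have hc : ContinuousOn R (Set.Icc 0 1) := by
    unfold R
    fun_prop
  obtain ⟨x, hx, hxy⟩ := intermediate_value_Icc zero_le_one hc
    (show y ∈ Set.Icc (R 0) (R 1) by
      constructor
      · simpa [R] using hy.1
      · have := hy.2
        norm_num [R]
        linarith)
  exact ⟨x, ⟨hx.1, hx.2.trans one_le_cpt⟩, hxy⟩

theorem R_phi1 {y : ℝ} (hy : y ∈ Set.Icc (0 : ℝ) 6) : R (phi1 y) = y :=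
  Function.invFunOn_eq (mem_image_R hy)

theorem phi1_mem_unit {y : ℝ} (hy : y ∈ Set.Icc (0 : ℝ) 6) : phi1 y ∈ Set.Icc (0 : ℝ) 1 := by
  have hm : phi1 y ∈ Set.Icc 0 cpt := Function.invFunOn_mem (mem_image_R hy)
  have hR := R_phi1 hy
  refine ⟨hm.1, ?_⟩
  by_contra! h
  have hu : phi1 y ≤ 5 / 4 := hm.2.trans cpt_le
  have h6 := hy.2
  unfold R at hR
  generalize phi1 y = x at *
  have h1 : 7 / 4 ≤ x * (3 - x) := by nlinarith
  nlinarith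

theorem le_fifteen_mul_phi1 {y : ℝ} (hy : y ∈ Set.Icc (0 : ℝ) 6) : y ≤ 15 * phi1 y := by
  have hR := R_phi1 hy
  obtain ⟨h0, h1⟩ := phi1_mem_unit hy
  unfold R at hR
  generalize phi1 y = x at *
  nlinarith [mul_nonneg (mul_nonneg h0 h0) (by linarith : 0 ≤ 8 - x)]

/-- The quantity `15^j λ_j (1 + λ_j)` does not increase along the iteration of `φ₁`. -/
theorem fifteen_mul_phi1_mul_le {y : ℝ} (hy : y ∈ Set.Icc (0 : ℝ) 6) :
    15 * (phi1 y * (1 + phi1 y)) ≤ y * (1 + y) := by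
  have hR := R_phi1 hy
  obtain ⟨h0, h1⟩ := phi1_mem_unit hy
  unfold R at hR
  generalize phi1 y = x at *
  have hlow : 15 * x - 8 * x ^ 2 ≤ y := by
    nlinarith [pow_nonneg h0 3]
  have h8 : 7 * x ≤ y := by nlinarith
  nlinarith [mul_self_le_mul_self (by linarith : 0 ≤ 7 * x) h8, sq_nonneg x]

/-- For `λ ∈ [0, 4+√2]` and `λ_0 = λ`, `λ_{j+1} = φ₁(λ_j)`, the
sequence `j ↦ 15^j λ_j` is nondecreasing and converges to a finite limit. -/
theorem renormalized_iterates_converge (lam : ℝ)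
    (hlam : lam ∈ Set.Icc (0 : ℝ) (4 + Real.sqrt 2)) :
    Monotone (fun j => (15 : ℝ) ^ j *
      (Nat.rec (motive := fun _ => ℝ) lam (fun _ x => phi1 x) j)) ∧
    ∃ L : ℝ, Filter.Tendsto (fun j => (15 : ℝ) ^ j *
      (Nat.rec (motive := fun _ => ℝ) lam (fun _ x => phi1 x) j)) Filter.atTop (nhds L) := by
  set u : ℕ → ℝ := fun j => Nat.rec (motive := fun _ => ℝ) lam (fun _ x => phi1 x) j with hu
  have hs : ∀ j, u (j + 1) = phi1 (u j) := fun _ => rfl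
  have h2 : Real.sqrt 2 ≤ 2 := Real.sqrt_le_iff.mpr (by norm_num)
  have hmem : ∀ j, u j ∈ Set.Icc (0 : ℝ) 6 := by
    intro j
    induction j with
    | zero => exact ⟨hlam.1, hlam.2.trans (by linarith)⟩
    | succ j ih =>
      obtain ⟨h0, h1⟩ := phi1_mem_unit ih
      rw [hs]
      exact ⟨h0, by linarith⟩
  have hmono : Monotone (fun j => (15 : ℝ) ^ j * u j) := by
    refine monotone_nat_of_le_succ fun j => ?_
    rw [hs, pow_succ, mul_assoc]
    exact mul_le_mul_of_nonneg_left (le_fifteen_mul_phi1 (hmem j)) (by positivity)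
  have hanti : Antitone (fun j => (15 : ℝ) ^ j * (u j * (1 + u j))) := by
    refine antitone_nat_of_succ_le fun j => ?_
    rw [hs, pow_succ, mul_assoc]
    exact mul_le_mul_of_nonneg_left (fifteen_mul_phi1_mul_le (hmem j)) (by positivity)
  refine ⟨hmono, _, tendsto_atTop_ciSup hmono ⟨lam * (1 + lam), ?_⟩⟩
  rintro _ ⟨j, rfl⟩
  have hle : (15 : ℝ) ^ j * u j ≤ (15 : ℝ) ^ j * (u j * (1 + u j)) := by
    have := (hmem j).1
    gcongr
    nlinarith
  exact hle.trans (by simpa [hu] using hanti (Nat.zero_le j))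

end VNLE
end
end

section
/- There exists a constant M such that |D_m f(j/3^m)| ≤ M for all m ≥ m₀ and all 0 ≤ j < 3^m. -/
open scoped BigOperators

noncomputable section

namespace VNLE

/-- On `[0, 4 + √2]` the branch `φ₁` takes values in `[0, 7/10]` and contracts by `1/8`. -/
lemma phi1_bounds {t : ℝ} (ht : t ∈ Set.Icc (0 : ℝ) (4 + Real.sqrt 2)) :
    0 ≤ phi1 t ∧ phi1 t ≤ 7 / 10 ∧ 8 * phi1 t ≤ t := by
  have h2 : Real.sqrt 2 ≤ 3 / 2 := by
    rw [Real.sqrt_le_left (by norm_num)]; norm_num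
  have h19 : Real.sqrt 19 ≤ 5 := by
    rw [Real.sqrt_le_left (by norm_num)]; norm_num
  have h19' : (41 / 10 : ℝ) ≤ Real.sqrt 19 := by
    apply Real.le_sqrt_of_sq_le; norm_num
  obtain ⟨ht0, ht1⟩ := ht
  have hex : ∃ x ∈ Set.Icc (0 : ℝ) cpt, R x = t := by
    have hcont : ContinuousOn R (Set.Icc 0 1) := by
      unfold R; fun_prop
    obtain ⟨x, hx, hxt⟩ := intermediate_value_Icc zero_le_one hcont
      (show t ∈ Set.Icc (R 0) (R 1) by constructor <;> norm_num [R] <;> linarith)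
    refine ⟨x, ⟨hx.1, hx.2.trans ?_⟩, hxt⟩
    unfold cpt; linarith
  obtain ⟨hx0, hxc⟩ := Function.invFunOn_mem hex
  have hR : R (phi1 t) = t := Function.invFunOn_eq hex
  change 0 ≤ phi1 t at hx0
  change phi1 t ≤ cpt at hxc
  generalize phi1 t = x at *
  have hx13 : x ≤ 13 / 10 := by unfold cpt at hxc; linarith
  unfold R at hR
  have hx1 : x ≤ 1 := by
    by_contra! h
    nlinarith [mul_pos (sub_pos.2 h) (show (0 : ℝ) < 3 - x by linarith),
      mul_nonneg (sub_nonneg.2 hx13) (show (0 : ℝ) ≤ 3 - x by linarith),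
      mul_nonneg (mul_nonneg (sub_nonneg.2 h.le) (show (0 : ℝ) ≤ 3 - x by linarith))
        (show (0 : ℝ) ≤ 5 - x by linarith)]
  have h8 : 8 * x ≤ t := by
    nlinarith [mul_nonneg hx0 (mul_nonneg (sub_nonneg.2 hx1) (show (0 : ℝ) ≤ 7 - x by linarith))]
  exact ⟨hx0, by linarith, h8⟩

/-- A bound on the value and on the rescaled outer increment of one extension step. -/
lemma extension_outer_bound {a b y p B : ℝ} (hy0 : 0 ≤ y) (hy1 : y ≤ 7 / 10) (hp : 1 ≤ p)
    (ha : |a| ≤ B) (hb : |b| ≤ B) (hd : |p * (b - a)| ≤ B) :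
    |((2 - y) * a + b) / ((1 - y) * (3 - y))| ≤ B * (1 + 18 * (p * y)) ∧
    |3 * p * (((2 - y) * a + b) / ((1 - y) * (3 - y)) - a)| ≤ B * (1 + 18 * (p * y)) := by
  have h1 : 0 < 1 - y := by linarith
  have h3 : 0 < 3 - y := by linarith
  have hQ : 0 < (1 - y) * (3 - y) := mul_pos h1 h3
  have hB : 0 ≤ B := (abs_nonneg a).trans ha
  have hpy : y ≤ p * y := le_mul_of_one_le_left hy0 hp
  have hinv : 1 / (1 - y) ≤ 1 + 4 * y := by
    rw [div_le_iff₀ h1]; nlinarith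
  have hinv0 : y / (1 - y) ≤ 4 * y := by
    rw [div_le_iff₀ h1]; nlinarith
  have hinv3 : 3 / ((1 - y) * (3 - y)) ≤ 1 + 6 * y := by
    rw [div_le_iff₀ hQ]
    nlinarith [mul_nonneg hy0 (sub_nonneg.2 hy1), mul_nonneg hy0 (mul_nonneg hy0 hy0)]
  constructor
  · have hnum : |(2 - y) * a + b| ≤ (3 - y) * B := by
      rw [abs_le] at *; constructor <;> nlinarith
    calc |((2 - y) * a + b) / ((1 - y) * (3 - y))|
        = |(2 - y) * a + b| / ((1 - y) * (3 - y)) := by rw [abs_div, abs_of_pos hQ]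
      _ ≤ (3 - y) * B / ((1 - y) * (3 - y)) := by gcongr
      _ = B * (1 / (1 - y)) := by field_simp
      _ ≤ B * (1 + 18 * (p * y)) := by gcongr; linarith
  · calc |3 * p * (((2 - y) * a + b) / ((1 - y) * (3 - y)) - a)|
        = |3 / ((1 - y) * (3 - y)) * (p * (b - a)) + 3 * p * (y / (1 - y)) * a| := by
          congr 1; field_simp; ring
      _ ≤ 3 / ((1 - y) * (3 - y)) * |p * (b - a)| + 3 * p * (y / (1 - y)) * |a| := by
          refine (abs_add_le _ _).trans_eq ?_
          rw [abs_mul, abs_mul _ a, abs_of_pos (show 0 < 3 / ((1 - y) * (3 - y)) by positivity),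
            abs_of_nonneg (show 0 ≤ 3 * p * (y / (1 - y)) by positivity)]
      _ ≤ (1 + 6 * y) * B + 3 * p * (4 * y) * B := by gcongr
      _ ≤ B * (1 + 18 * (p * y)) := by nlinarith [mul_le_mul_of_nonneg_left hpy hB]

/-- A bound on the rescaled middle increment of one extension step. -/
lemma extension_middle_bound {a b y p B : ℝ} (hy0 : 0 ≤ y) (hy1 : y ≤ 7 / 10) (hp : 1 ≤ p)
    (hd : |p * (b - a)| ≤ B) :
    |3 * p * ((a + (2 - y) * b) / ((1 - y) * (3 - y)) -
      ((2 - y) * a + b) / ((1 - y) * (3 - y)))| ≤ B * (1 + 18 * (p * y)) := by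
  have h1 : 0 < 1 - y := by linarith
  have h3 : 0 < 3 - y := by linarith
  have hB : 0 ≤ B := (abs_nonneg _).trans hd
  have hpy : y ≤ p * y := le_mul_of_one_le_left hy0 hp
  have hinv : 3 / (3 - y) ≤ 1 + 18 * (p * y) := by
    rw [div_le_iff₀ h3]; nlinarith
  calc |3 * p * ((a + (2 - y) * b) / ((1 - y) * (3 - y)) -
      ((2 - y) * a + b) / ((1 - y) * (3 - y)))|
      = |3 / (3 - y) * (p * (b - a))| := by congr 1; field_simp; ring
    _ = |p * (b - a)| * (3 / (3 - y)) := by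
        rw [abs_mul, abs_of_pos (show 0 < 3 / (3 - y) by positivity), mul_comm]
    _ ≤ B * (1 + 18 * (p * y)) := by gcongr

/-- The difference quotients `D_m f(j/3^m) = 3^m(f((j+1)/3^m) − f(j/3^m))`
are uniformly bounded. -/
theorem difference_quotients_bounded
    (m₀ : ℕ) (hm₀ : 1 ≤ m₀) (lam : ℕ → ℝ)
    (hlam0 : lam m₀ ∈ Set.Icc (0 : ℝ) (4 + Real.sqrt 2))
    (hlam : ∀ m, m₀ ≤ m → lam (m + 1) = phi1 (lam m))
    (f : ℕ → ℕ → ℝ)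
    (hwrap : ∀ m, m₀ ≤ m → f m (3 ^ m) = f m 0)
    (hcons : ∀ m, m₀ ≤ m → ∀ j, j < 3 ^ m → f (m + 1) (3 * j) = f m j)
    (hrec1 : ∀ m, m₀ ≤ m → ∀ j, j < 3 ^ m →
      f (m + 1) (3 * j + 1) =
        ((2 - lam (m + 1)) * f m j + f m (j + 1)) /
          ((1 - lam (m + 1)) * (3 - lam (m + 1))))
    (hrec2 : ∀ m, m₀ ≤ m → ∀ j, j < 3 ^ m →
      f (m + 1) (3 * j + 2) =
        (f m j + (2 - lam (m + 1)) * f m (j + 1)) /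
          ((1 - lam (m + 1)) * (3 - lam (m + 1)))) :
    ∃ M : ℝ, ∀ m j, m₀ ≤ m → j < 3 ^ m →
      |(3 : ℝ) ^ m * (f m (j + 1) - f m j)| ≤ M := by
  have hwindow : ∀ k, lam (m₀ + k) ∈ Set.Icc (0 : ℝ) (4 + Real.sqrt 2) ∧
      lam (m₀ + k + 1) ≤ 7 / 10 * (1 / 8) ^ k := by
    intro k
    induction k with
    | zero => exact ⟨hlam0, by simpa [hlam m₀ le_rfl] using (phi1_bounds hlam0).2.1⟩
    | succ k ih =>
      obtain ⟨hmem, hle⟩ := ih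
      have hstep := phi1_bounds hmem
      rw [← hlam _ (Nat.le_add_right _ _)] at hstep
      have hmem' : lam (m₀ + k + 1) ∈ Set.Icc (0 : ℝ) (4 + Real.sqrt 2) :=
        ⟨hstep.1, by linarith [hstep.2.1, Real.sqrt_nonneg 2]⟩
      have hnext := (phi1_bounds hmem').2.2
      rw [← hlam _ (by omega)] at hnext
      refine ⟨hmem', ?_⟩
      rw [pow_succ]
      change lam (m₀ + k + 1 + 1) ≤ _
      linarith
  obtain ⟨B, hB⟩ : ∃ B : ℝ, ∀ j ∈ Finset.range (3 ^ m₀ + 1),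
      |f m₀ j| + |(3 : ℝ) ^ m₀ * (f m₀ (j + 1) - f m₀ j)| ≤ B := by
    obtain ⟨B, hB⟩ := ((Finset.range (3 ^ m₀ + 1)).image fun j =>
      |f m₀ j| + |(3 : ℝ) ^ m₀ * (f m₀ (j + 1) - f m₀ j)|).bddAbove
    exact ⟨B, fun j hj => hB (Finset.mem_coe.2 (Finset.mem_image_of_mem _ hj))⟩
  have hB0 : 0 ≤ B := le_trans (by positivity) (hB 0 (by simp))
  set C : ℝ := 18 * 3 ^ m₀ with hC
  have hC0 : 0 ≤ C := by positivity
  have key : ∀ k, ∀ j ≤ 3 ^ (m₀ + k),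
      |f (m₀ + k) j| ≤ B * Real.exp (C * (8 / 5) * (1 - (3 / 8) ^ k)) ∧
      (j < 3 ^ (m₀ + k) → |(3 : ℝ) ^ (m₀ + k) * (f (m₀ + k) (j + 1) - f (m₀ + k) j)| ≤
        B * Real.exp (C * (8 / 5) * (1 - (3 / 8) ^ k))) := by
    intro k
    induction k with
    | zero =>
      intro j hj
      have h := hB j (by simpa [Nat.lt_succ_iff] using hj)
      simp only [add_zero, pow_zero, sub_self, mul_zero, Real.exp_zero, mul_one]
      exact ⟨by linarith [abs_nonneg ((3 : ℝ) ^ m₀ * (f m₀ (j + 1) - f m₀ j))],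
        fun _ => by linarith [abs_nonneg (f m₀ j)]⟩
    | succ k ih =>
      set m := m₀ + k with hm
      have hmm : m₀ ≤ m := Nat.le_add_right _ _
      set E := B * Real.exp (C * (8 / 5) * (1 - (3 / 8) ^ k)) with hE
      set E' := B * Real.exp (C * (8 / 5) * (1 - (3 / 8) ^ (k + 1))) with hE'
      have hE0 : 0 ≤ E := by positivity
      set p : ℝ := 3 ^ m with hp
      have hp1 : 1 ≤ p := one_le_pow₀ (by norm_num)
      have hy := phi1_bounds (hwindow k).1
      rw [← hlam m hmm] at hy
      have hyk := (hwindow k).2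
      change lam (m + 1) ≤ _ at hyk
      change ∀ j ≤ 3 ^ (m + 1), |f (m + 1) j| ≤ E' ∧ (j < 3 ^ (m + 1) →
        |(3 : ℝ) ^ (m + 1) * (f (m + 1) (j + 1) - f (m + 1) j)| ≤ E')
      have hpow : (3 : ℝ) ^ (m + 1) = 3 * p := by rw [pow_succ, mul_comm]
      rw [hpow]
      have r1 := hrec1 m hmm
      have r2 := hrec2 m hmm
      have r0 : ∀ j ≤ 3 ^ m, f (m + 1) (3 * j) = f m j := by
        intro j hj
        rcases hj.lt_or_eq with hj | rfl
        · exact hcons m hmm j hj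
        · rw [← pow_succ', hwrap (m + 1) (by omega), hwrap m hmm]
          exact hcons m hmm 0 (by positivity)
      generalize lam (m + 1) = y at *
      obtain ⟨hy0, hy1, -⟩ := hy
      have hpy : 18 * (p * y) ≤ C * (3 / 8) ^ k := by
        calc 18 * (p * y) ≤ 18 * (p * (1 / 8) ^ k) := by
              gcongr
              exact hyk.trans (mul_le_of_le_one_left (by positivity) (by norm_num))
          _ = C * (3 / 8) ^ k := by
              rw [hp, hm, hC, pow_add, div_pow, div_pow, one_pow]; ring
      have hgrow : E * (1 + 18 * (p * y)) ≤ E' := by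
        calc E * (1 + 18 * (p * y)) ≤ E * Real.exp (C * (3 / 8) ^ k) := by
              gcongr
              linarith [Real.add_one_le_exp (C * (3 / 8) ^ k)]
          _ = E' := by
              rw [hE, hE', mul_assoc, ← Real.exp_add, pow_succ]
              congr 2; ring
      have hEE' : E ≤ E' := by
        refine le_trans ?_ hgrow
        exact le_mul_of_one_le_right hE0 (by nlinarith)
      intro j hj
      obtain ⟨q, rfl | rfl | rfl⟩ : ∃ q, j = 3 * q ∨ j = 3 * q + 1 ∨ j = 3 * q + 2 :=
        ⟨j / 3, by omega⟩
      · have hq : q ≤ 3 ^ m := by rw [pow_succ] at hj; omega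
        rw [r0 q hq]
        refine ⟨(ih q hq).1.trans hEE', fun hlt => ?_⟩
        have hq' : q < 3 ^ m := by rw [pow_succ] at hlt; omega
        rw [r1 q hq']
        exact (extension_outer_bound hy0 hy1 hp1 (ih q hq).1 (ih (q + 1) hq').1
          ((ih q hq).2 hq')).2.trans hgrow
      · have hq : q < 3 ^ m := by rw [pow_succ] at hj; omega
        rw [show 3 * q + 1 + 1 = 3 * q + 2 from rfl, r1 q hq, r2 q hq]
        exact ⟨(extension_outer_bound hy0 hy1 hp1 (ih q hq.le).1 (ih (q + 1) hq).1
          ((ih q hq.le).2 hq)).1.trans hgrow,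
          fun _ => (extension_middle_bound hy0 hy1 hp1 ((ih q hq.le).2 hq)).trans hgrow⟩
      · have hq : q < 3 ^ m := by rw [pow_succ] at hj; omega
        have hrev := extension_outer_bound hy0 hy1 hp1 (ih (q + 1) hq).1 (ih q hq.le).1
          (by rw [← abs_neg, ← mul_neg, neg_sub]; exact (ih q hq.le).2 hq)
        rw [add_comm ((2 - y) * f m (q + 1))] at hrev
        rw [show 3 * q + 2 + 1 = 3 * (q + 1) from rfl, r2 q hq, r0 (q + 1) hq]
        refine ⟨hrev.1.trans hgrow, fun _ => ?_⟩
        rw [← abs_neg, ← mul_neg, neg_sub]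
        exact hrev.2.trans hgrow
  refine ⟨B * Real.exp (C * (8 / 5)), fun m j hm hj => ?_⟩
  obtain ⟨k, rfl⟩ := Nat.exists_eq_add_of_le hm
  refine ((key k j hj.le).2 hj).trans ?_
  refine mul_le_mul_of_nonneg_left (Real.exp_le_exp.2 ?_) hB0
  refine mul_le_of_le_one_right (by positivity) ?_
  linarith [show (0 : ℝ) ≤ (3 / 8) ^ k by positivity]

end VNLE
end
end

section
/- For all m ≥ m₀ and 0 ≤ j < 3^m, writing λ' = λ_{m+1}, the following three identities hold: D_{m+1} f(3j/3^{m+1}) = D_m f(j/3^m)/((1−λ')(1−λ'/3)) + (3^{m+1} λ'/(1−λ')) f(j/3^m); D_{m+1} f((3j+1)/3^{m+1}) = D_m f(j/3^m)/(1−λ'/3); and D_{m+1} f((3j+2)/3^{m+1}) = D_m f(j/3^m)/((1−λ')(1−λ'/3)) − (3^{m+1} λ'/(1−λ')) f((j+1)/3^m). -/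
open scoped BigOperators

noncomputable section

namespace VNLE

theorem cpt_le_four_thirds : cpt ≤ 4 / 3 := by
  have h : 4 ≤ Real.sqrt 19 := Real.le_sqrt_of_sq_le (by norm_num)
  unfold cpt
  linarith

/-- `φ₁` maps `[0, 8)` into `[0, 1)`, since `R 0 = 0` and `R 1 = 8`. -/
theorem phi1_mem_Ico {x : ℝ} (hx : x ∈ Set.Ico (0 : ℝ) 8) : phi1 x ∈ Set.Ico (0 : ℝ) 1 := by
  have hcont : ContinuousOn R (Set.Icc 0 1) := by
    unfold R
    fun_prop
  have hex : ∃ a ∈ Set.Icc 0 cpt, R a = x := by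
    obtain ⟨a, ha, hax⟩ := intermediate_value_Icc zero_le_one hcont
      (show x ∈ Set.Icc (R 0) (R 1) by
        norm_num [R]
        exact ⟨hx.1, hx.2.le⟩)
    exact ⟨a, ⟨ha.1, ha.2.trans one_le_cpt⟩, hax⟩
  have hmem : phi1 x ∈ Set.Icc 0 cpt := Function.invFunOn_mem hex
  have heq : R (phi1 x) = x := Function.invFunOn_eq hex
  refine ⟨hmem.1, ?_⟩
  by_contra! h
  have hle : phi1 x ≤ 4 / 3 := hmem.2.trans cpt_le_four_thirds
  have hlt : R (phi1 x) < 8 := heq.trans_lt hx.2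
  generalize phi1 x = y at h hle hlt
  have hfac : 0 ≤ (y - 1) * (y ^ 2 - 7 * y + 8) :=
    mul_nonneg (by linarith) (by nlinarith)
  unfold R at hlt
  linarith

/-- The three identities (4.4) relating `D_{m+1} f` to `D_m f`,
writing `λ' = λ_{m+1}`. -/
theorem difference_quotient_identities
    (m₀ : ℕ) (hm₀ : 1 ≤ m₀) (lam : ℕ → ℝ)
    (hlam0 : lam m₀ ∈ Set.Icc (0 : ℝ) (4 + Real.sqrt 2))
    (hlam : ∀ m, m₀ ≤ m → lam (m + 1) = phi1 (lam m))
    (f : ℕ → ℕ → ℝ)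
    (hwrap : ∀ m, m₀ ≤ m → f m (3 ^ m) = f m 0)
    (hcons : ∀ m, m₀ ≤ m → ∀ j, j < 3 ^ m → f (m + 1) (3 * j) = f m j)
    (hrec1 : ∀ m, m₀ ≤ m → ∀ j, j < 3 ^ m →
      f (m + 1) (3 * j + 1) =
        ((2 - lam (m + 1)) * f m j + f m (j + 1)) /
          ((1 - lam (m + 1)) * (3 - lam (m + 1))))
    (hrec2 : ∀ m, m₀ ≤ m → ∀ j, j < 3 ^ m →
      f (m + 1) (3 * j + 2) =
        (f m j + (2 - lam (m + 1)) * f m (j + 1)) /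
          ((1 - lam (m + 1)) * (3 - lam (m + 1)))) :
    ∀ m j, m₀ ≤ m → j < 3 ^ m →
      (3 : ℝ) ^ (m + 1) * (f (m + 1) (3 * j + 1) - f (m + 1) (3 * j)) =
        ((3 : ℝ) ^ m * (f m (j + 1) - f m j)) /
          ((1 - lam (m + 1)) * (1 - lam (m + 1) / 3)) +
        (3 : ℝ) ^ (m + 1) * lam (m + 1) / (1 - lam (m + 1)) * f m j ∧
      (3 : ℝ) ^ (m + 1) * (f (m + 1) (3 * j + 2) - f (m + 1) (3 * j + 1)) =
        ((3 : ℝ) ^ m * (f m (j + 1) - f m j)) / (1 - lam (m + 1) / 3) ∧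
      (3 : ℝ) ^ (m + 1) * (f (m + 1) (3 * j + 3) - f (m + 1) (3 * j + 2)) =
        ((3 : ℝ) ^ m * (f m (j + 1) - f m j)) /
          ((1 - lam (m + 1)) * (1 - lam (m + 1) / 3)) -
        (3 : ℝ) ^ (m + 1) * lam (m + 1) / (1 - lam (m + 1)) * f m (j + 1) := by
  have hmem : ∀ m, m₀ ≤ m → lam m ∈ Set.Ico (0 : ℝ) 8 := by
    intro m hm
    induction m, hm using Nat.le_induction with
    | base =>
      have h : Real.sqrt 2 ≤ 2 := Real.sqrt_le_iff.mpr (by norm_num)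
      exact ⟨hlam0.1, by linarith [hlam0.2]⟩
    | succ m hm ih =>
      have h := phi1_mem_Ico ih
      rw [hlam m hm]
      exact ⟨h.1, by linarith [h.2]⟩
  intro m j hm hj
  have hlt : lam (m + 1) < 1 := hlam m hm ▸ (phi1_mem_Ico (hmem m hm)).2
  have hlast : f (m + 1) (3 * j + 3) = f m (j + 1) := by
    rcases Nat.lt_or_ge (j + 1) (3 ^ m) with h | h
    · exact hcons m hm (j + 1) h
    · obtain h : j + 1 = 3 ^ m := by omega
      have h' : 3 * j + 3 = 3 ^ (m + 1) := by
        rw [pow_succ]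
        omega
      rw [h, h', hwrap (m + 1) (by omega), hwrap m hm]
      exact hcons m hm 0 (by positivity)
  rw [hlast, hcons m hm j hj, hrec1 m hm j hj, hrec2 m hm j hj]
  generalize lam (m + 1) = x at hlt
  have h1 : 1 - x ≠ 0 := by linarith
  have h3 : 3 - x ≠ 0 := by linarith
  have h3' : 1 - x / 3 = (3 - x) / 3 := by ring
  rw [h3']
  refine ⟨?_, ?_, ?_⟩ <;>
  · field_simp
    ring

end VNLE
end
end
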